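/- arXiv:1509.00420 — 2 statements merged into one kernel-verified Lean document; each statement's English description precedes it below -/
import Mathlib

section
/- Let A be a left brace. If Aⁿ = 0 and A^{(m)} = 0 for some natural numbers m, n, then the adjoint group A° of A is a nilpotent group. -/
namespace Paper

/-- A left brace: an abelian group `(A,+)` with a multiplication `bmul` that is left
distributive over addition and such that the circle operation
`a ∘ b = a·b + a + b` makes `A` into a group (the adjoint group) with identity `0`. -/
class LeftBrace (A : Type*) extends AddCommGroup A where
  bmul : A → A → A
  bmul_add : ∀ a b c : A, bmul a (b + c) = bmul a b + bmul a c
  circ_assoc : ∀ a b c : A,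
    bmul (bmul a b + a + b) c + (bmul a b + a + b) + c
      = bmul a (bmul b c + b + c) + a + (bmul b c + b + c)
  zero_circ : ∀ a : A, bmul 0 a + 0 + a = a
  circ_zero : ∀ a : A, bmul a 0 + a + 0 = a
  exists_circ_inv : ∀ a : A, ∃ b : A, bmul a b + a + b = 0 ∧ bmul b a + b + a = 0

namespace LeftBrace

variable {A : Type*} [LeftBrace A]

/-- The circle operation `a ∘ b = a·b + a + b` of a left brace. -/
def circ (a b : A) : A := bmul a b + a + b

/-- The adjoint group `A°` of a left brace: the group `(A, ∘)`. -/
noncomputable def adjointGroup (A : Type*) [LeftBrace A] : Group A where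
  mul := circ
  one := (0 : A)
  inv a := Classical.choose (exists_circ_inv a)
  mul_assoc := circ_assoc
  one_mul := zero_circ
  mul_one := circ_zero
  inv_mul_cancel a := (Classical.choose_spec (exists_circ_inv a)).2

/-- The adjoint group `A°` of the left brace `A` is a nilpotent group. -/
def AdjointNilpotent (A : Type*) [LeftBrace A] : Prop :=
  @Group.IsNilpotent A (adjointGroup A)

/-- For subsets `C, D ⊆ A`, `C · D` is the set of all finite sums `Σ cᵢ·dᵢ`
with `cᵢ ∈ C`, `dᵢ ∈ D`, i.e. the additive submonoid generated by the products. -/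
def setMulSub (C D : Set A) : AddSubmonoid A :=
  AddSubmonoid.closure {x : A | ∃ c ∈ C, ∃ d ∈ D, x = bmul c d}

/-- `C · D` as a set. -/
def setMul (C D : Set A) : Set A := (setMulSub C D : Set A)

/-- `pow A n = Aⁿ` for `n ≥ 1`: `A¹ = A`, `A^{n+1} = A · Aⁿ`.  (`pow A 0` is set to `A`.) -/
def pow (A : Type*) [LeftBrace A] : ℕ → Set A
  | 0 => Set.univ
  | 1 => Set.univ
  | (n+2) => setMul Set.univ (pow A (n+1))

/-- `rpow A n = A^{(n)}` for `n ≥ 1`: `A^{(1)} = A`, `A^{(n+1)} = A^{(n)} · A`.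
(`rpow A 0` is set to `A`.) -/
def rpow (A : Type*) [LeftBrace A] : ℕ → Set A
  | 0 => Set.univ
  | 1 => Set.univ
  | (n+2) => setMul (rpow A (n+1)) Set.univ

/-- `brk A n = A^{[n]}` for `n ≥ 1`: `A^{[1]} = A`,
`A^{[n+1]} = Σ_{i=1}^{n} A^{[i]} · A^{[n+1-i]}`.  (`brk A 0` is set to `A`.) -/
def brk (A : Type*) [LeftBrace A] : ℕ → Set A
  | 0 => Set.univ
  | 1 => Set.univ
  | (n+2) =>
    (((Finset.range (n+1)).attach.sup
      (fun i => setMulSub (brk A (i.1 + 1)) (brk A (n + 1 - i.1)))) : AddSubmonoid A)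
  decreasing_by
  · have h := i.2; simp only [Finset.mem_range] at h; omega
  · omega


/-- The product of a family of left braces, with componentwise operations. -/
noncomputable def piBrace {ι : Type*} (B : ι → Type*) (instB : ∀ i, LeftBrace (B i)) :
    LeftBrace (∀ i, B i) :=
  letI : ∀ i, LeftBrace (B i) := instB
  { (inferInstance : AddCommGroup (∀ i, B i)) with
    bmul := fun f g i => bmul (f i) (g i)
    bmul_add := fun a b c => funext fun i => bmul_add (a i) (b i) (c i)
    circ_assoc := fun a b c => funext fun i => circ_assoc (a i) (b i) (c i)
    zero_circ := fun a => funext fun i => zero_circ (a i)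
    circ_zero := fun a => funext fun i => circ_zero (a i)
    exists_circ_inv := fun a =>
      ⟨fun i => Classical.choose (exists_circ_inv (a i)),
        funext fun i => (Classical.choose_spec (exists_circ_inv (a i))).1,
        funext fun i => (Classical.choose_spec (exists_circ_inv (a i))).2⟩ }

/-- An isomorphism of left braces: an additive isomorphism preserving the brace
multiplication. -/
structure BraceIso (A B : Type*) [LeftBrace A] [LeftBrace B] extends A ≃+ B where
  map_bmul : ∀ a b : A, toAddEquiv (bmul a b) = bmul (toAddEquiv a) (toAddEquiv b)

/-- `A` is the direct sum of (finitely many) left braces whose cardinalities are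
powers of prime numbers. -/
def IsPrimePowerDirectSum (A : Type*) [LeftBrace A] : Prop :=
  ∃ (k : ℕ) (B : Fin k → Type) (instB : ∀ i, LeftBrace (B i)),
    (∀ i, ∃ p m : ℕ, p.Prime ∧ Nat.card (B i) = p ^ m) ∧
    Nonempty (@BraceIso A (∀ i, B i) _ (piBrace B instB))

section Adjoint

open scoped commutatorElement

attribute [local instance] adjointGroup

/-- The additive map `b ↦ a·b + b` attached to an element `a` of a left brace. -/
def lam (a : A) : A →+ A :=
  AddMonoidHom.mk' (fun b => bmul a b + b) fun b c => by rw [bmul_add]; abel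

lemma lam_apply (a b : A) : lam a b = bmul a b + b := rfl

lemma bmul_eq_lam_sub (a b : A) : bmul a b = lam a b - b := by simp [lam_apply]

lemma adjoint_one_eq_zero : (1 : A) = 0 := rfl

lemma adjoint_mul_eq (a b : A) : a * b = bmul a b + a + b := rfl

lemma adjoint_mul_eq_lam_add (a b : A) : a * b = lam a b + a := by
  rw [adjoint_mul_eq, lam_apply]; abel

lemma lam_adjoint_mul (a b c : A) : lam (a * b) c = lam a (lam b c) := by
  have h : a * b * c = a * (b * c) := mul_assoc a b c
  rw [adjoint_mul_eq_lam_add (a * b), adjoint_mul_eq_lam_add a (b * c),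
    adjoint_mul_eq_lam_add b c, adjoint_mul_eq_lam_add a b, map_add, add_assoc (lam a (lam b c))] at h
  rw [adjoint_mul_eq_lam_add a b]
  exact add_right_cancel h

lemma lam_one (a : A) : lam 1 a = a := by
  have h : (1 : A) * a = a := one_mul a
  rwa [adjoint_mul_eq_lam_add, adjoint_one_eq_zero, add_zero] at h

lemma lam_lam_inv (a b : A) : lam a (lam a⁻¹ b) = b := by
  rw [← lam_adjoint_mul, mul_inv_cancel, lam_one]

lemma add_eq_adjoint_mul (a b : A) : b + a = a * lam a⁻¹ b := by
  rw [adjoint_mul_eq_lam_add, lam_lam_inv]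

lemma bmul_neg (a b : A) : bmul a (-b) = -bmul a b := by
  simp only [bmul_eq_lam_sub, map_neg]; abel

lemma lam_bmul (a h b : A) : lam a (bmul h b) = bmul (a * h * a⁻¹) (lam a b) := by
  rw [bmul_eq_lam_sub h, bmul_eq_lam_sub, map_sub, ← lam_adjoint_mul, ← lam_adjoint_mul,
    inv_mul_cancel_right]

lemma conj_eq (a h : A) : a * h * a⁻¹ = lam a (bmul h a⁻¹) + lam a h := by
  have h1 : lam a a⁻¹ + a = 0 := by
    rw [← adjoint_mul_eq_lam_add, mul_inv_cancel, adjoint_one_eq_zero]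
  rw [mul_assoc, adjoint_mul_eq_lam_add a, adjoint_mul_eq, map_add, map_add, add_assoc, h1,
    add_zero]

lemma bmul_mem_setMul {C D : Set A} {c d : A} (hc : c ∈ C) (hd : d ∈ D) :
    bmul c d ∈ setMul C D :=
  AddSubmonoid.subset_closure ⟨c, hc, d, hd, rfl⟩

/-- The additive subgroup `C · A`. -/
def mulUniv (C : Set A) : AddSubgroup A where
  toAddSubmonoid := setMulSub C Set.univ
  neg_mem' {x} hx := by
    change x ∈ setMulSub C Set.univ at hx
    change -x ∈ setMulSub C Set.univ
    induction hx using AddSubmonoid.closure_induction with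
    | mem x h =>
      obtain ⟨c, hc, d, -, rfl⟩ := h
      rw [← bmul_neg]
      exact bmul_mem_setMul hc (Set.mem_univ _)
    | zero => rw [neg_zero]; exact zero_mem _
    | add x y _ _ hx hy => rw [neg_add]; exact add_mem hx hy

/-- An additive subgroup `I` with `A·I ⊆ I` and `I·A ⊆ I`. -/
structure IsBraceIdeal (I : AddSubgroup A) : Prop where
  bmul_left_mem : ∀ a, ∀ x ∈ I, bmul a x ∈ I
  bmul_right_mem : ∀ a, ∀ x ∈ I, bmul x a ∈ I

lemma IsBraceIdeal.lam_mem {I : AddSubgroup A} (hI : IsBraceIdeal I) (a : A) {x : A}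
    (hx : x ∈ I) : lam a x ∈ I :=
  add_mem (hI.bmul_left_mem a x hx) hx

lemma IsBraceIdeal.mulUniv_le {I : AddSubgroup A} (hI : IsBraceIdeal I) :
    mulUniv (I : Set A) ≤ I := by
  intro x hx
  change x ∈ setMulSub (I : Set A) Set.univ at hx
  induction hx using AddSubmonoid.closure_induction with
  | mem x h =>
    obtain ⟨c, hc, d, -, rfl⟩ := h
    exact hI.bmul_right_mem d c hc
  | zero => exact zero_mem _
  | add x y _ _ hx hy => exact add_mem hx hy

lemma IsBraceIdeal.mulUniv {I : AddSubgroup A} (hI : IsBraceIdeal I) :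
    IsBraceIdeal (mulUniv (I : Set A)) where
  bmul_left_mem a x hx := by
    rw [bmul_eq_lam_sub]
    refine sub_mem ?_ hx
    change x ∈ setMulSub (I : Set A) Set.univ at hx
    induction hx using AddSubmonoid.closure_induction with
    | mem x h =>
      obtain ⟨c, hc, d, -, rfl⟩ := h
      rw [lam_bmul]
      refine bmul_mem_setMul ?_ (Set.mem_univ _)
      rw [conj_eq]
      exact add_mem (hI.lam_mem a (hI.bmul_right_mem _ c hc)) (hI.lam_mem a hc)
    | zero => rw [map_zero]; exact zero_mem _
    | add x y _ _ hx hy => rw [map_add]; exact add_mem hx hy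
  bmul_right_mem a _ hx := bmul_mem_setMul (hI.mulUniv_le hx) (Set.mem_univ a)

lemma exists_isBraceIdeal_coe_eq_rpow (n : ℕ) :
    ∃ I : AddSubgroup A, IsBraceIdeal I ∧ (I : Set A) = rpow A (n + 1) := by
  induction n with
  | zero => exact ⟨⊤, ⟨fun _ _ _ => trivial, fun _ _ _ => trivial⟩, by simp [rpow]⟩
  | succ n ih =>
    obtain ⟨I, hI, h⟩ := ih
    refine ⟨LeftBrace.mulUniv (I : Set A), hI.mulUniv, ?_⟩
    rw [h]
    rfl

lemma setMul_mono_right {C D E : Set A} (h : D ⊆ E) : setMul C D ⊆ setMul C E :=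
  AddSubmonoid.closure_mono fun _ ⟨c, hc, d, hd, hx⟩ => ⟨c, hc, d, h hd, hx⟩

lemma pow_succ_subset (n : ℕ) : pow A (n + 2) ⊆ pow A (n + 1) := by
  induction n with
  | zero => exact Set.subset_univ _
  | succ n ih => exact setMul_mono_right ih

lemma add_mem_pow {n : ℕ} {x y : A} (hx : x ∈ pow A n) (hy : y ∈ pow A n) :
    x + y ∈ pow A n := by
  match n with
  | 0 | 1 => trivial
  | n + 2 => exact (setMulSub Set.univ (pow A (n + 1))).add_mem hx hy

lemma bmul_mem_pow_succ {n : ℕ} (a : A) {x : A} (hx : x ∈ pow A (n + 1)) :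
    bmul a x ∈ pow A (n + 2) :=
  bmul_mem_setMul (Set.mem_univ a) hx

lemma lam_mem_pow {n : ℕ} (a : A) {x : A} (hx : x ∈ pow A (n + 1)) :
    lam a x ∈ pow A (n + 1) :=
  add_mem_pow (pow_succ_subset n (bmul_mem_pow_succ a hx)) hx

lemma commutator_mem_of_lam_mem (Z : Subgroup A) [Z.Normal] {x a : A}
    (h₁ : lam (a + x)⁻¹ (bmul x a) ∈ Z) (h₂ : lam (a + x)⁻¹ (bmul a x) ∈ Z) :
    ⁅x, a⁆ ∈ Z := by
  have hxa : x * a = (a + x) * lam (a + x)⁻¹ (bmul x a) := by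
    rw [← add_eq_adjoint_mul, adjoint_mul_eq]; abel
  have hax : a * x = (a + x) * lam (a + x)⁻¹ (bmul a x) := by
    rw [← add_eq_adjoint_mul, adjoint_mul_eq]; abel
  have h : ⁅x, a⁆ = (x * a) * (a * x)⁻¹ := by
    rw [commutatorElement_def, mul_inv_rev]; simp only [mul_assoc]
  rw [h, hxa, hax, mul_inv_rev, mul_assoc, ← mul_assoc (lam _ _), ← mul_assoc]
  exact ‹Z.Normal›.conj_mem _ (mul_mem h₁ (inv_mem h₂)) _

lemma IsBraceIdeal.subset_upperCentralSeries_of_pow_eq_zero {I : AddSubgroup A}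
    (hI : IsBraceIdeal I) {n k : ℕ} (hn : pow A (n + 1) = {0})
    (hZ : ∀ x ∈ LeftBrace.mulUniv (I : Set A), x ∈ Subgroup.upperCentralSeries A k) :
    ∀ x ∈ I, x ∈ Subgroup.upperCentralSeries A (k + n) := by
  have key : ∀ j p, p + j = n → ∀ x ∈ I, x ∈ pow A (p + 1) →
      x ∈ Subgroup.upperCentralSeries A (k + j) := by
    intro j
    induction j with
    | zero =>
      rintro p rfl x - hx
      rw [show p + 1 = p + 0 + 1 from rfl, hn] at hx
      rw [Set.mem_singleton_iff.mp hx]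
      exact one_mem _
    | succ j ih =>
      intro p hp x hx hxp
      rw [← add_assoc, Subgroup.mem_upperCentralSeries_succ_iff]
      refine fun a => commutator_mem_of_lam_mem _ ?_ ?_
      · exact Subgroup.upperCentralSeries_mono A (Nat.le_add_right k j)
          (hZ _ (hI.mulUniv.lam_mem _ (bmul_mem_setMul hx (Set.mem_univ a))))
      · exact ih (p + 1) (by omega) _ (hI.lam_mem _ (hI.bmul_left_mem a x hx))
          (lam_mem_pow _ (bmul_mem_pow_succ a hxp))
  exact fun x hx => key n 0 (Nat.zero_add n) x hx (Set.mem_univ x)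

lemma exists_upperCentralSeries_eq_top_of_rpow_subset {n : ℕ} (hn : pow A (n + 1) = {0})
    (i k : ℕ) (h : rpow A (i + 1) ⊆ Subgroup.upperCentralSeries A k) :
    ∃ l, Subgroup.upperCentralSeries A l = ⊤ := by
  induction i generalizing k with
  | zero => exact ⟨k, eq_top_iff.mpr fun x _ => h (Set.mem_univ x)⟩
  | succ i ih =>
    obtain ⟨I, hI, hIr⟩ := exists_isBraceIdeal_coe_eq_rpow (A := A) i
    refine ih (k + n) ?_
    rw [← hIr]
    refine hI.subset_upperCentralSeries_of_pow_eq_zero hn fun x hx => h ?_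
    change x ∈ setMul (rpow A (i + 1)) Set.univ
    rwa [← hIr]

end Adjoint

/-- If `A` is a left brace with `Aⁿ = 0` and `A^{(m)} = 0` for some
natural numbers `m, n`, then the adjoint group `A°` of `A` is nilpotent. -/
theorem leftBrace_adjoint_nilpotent_of_pow_rpow
    (A : Type) [LeftBrace A] (m n : ℕ) (hm : 1 ≤ m) (hn : 1 ≤ n)
    (h1 : pow A n = {0}) (h2 : rpow A m = {0}) :
    AdjointNilpotent A := by
  obtain ⟨m, rfl⟩ := Nat.exists_eq_add_of_le' hm
  obtain ⟨n, rfl⟩ := Nat.exists_eq_add_of_le' hn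
  let _ := adjointGroup A
  refine ⟨exists_upperCentralSeries_eq_top_of_rpow_subset h1 m 0 ?_⟩
  rw [h2, Set.singleton_subset_iff]
  exact one_mem (Subgroup.upperCentralSeries A 0)

end LeftBrace

end Paper
end

section
/- Let s be a natural number and let A be a left brace such that Aˢ = 0. Let a, b ∈ A and define inductively elements d₀ = a, d₀' = b, and d_{i+1} = d_i + d_i', d_{i+1}' = d_i·d_i' for i ≥ 0. Then for every c ∈ A one has (a+b)·c = a·c + b·c + Σ_{i=0}^{2s} (−1)^{i+1}·((d_i·d_i')·c − d_i·(d_i'·c)). -/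
namespace Paper

namespace LeftBrace

variable {A : Type*} [LeftBrace A]

/-- The pair `(dᵢ, dᵢ')` from Lemma `fajny`: `d₀ = a`, `d₀' = b`,
`d_{i+1} = dᵢ + dᵢ'`, `d_{i+1}' = dᵢ · dᵢ'`. -/
def dSeq {A : Type*} [LeftBrace A] (a b : A) : ℕ → A × A
  | 0 => (a, b)
  | n + 1 => ((dSeq a b n).1 + (dSeq a b n).2, bmul (dSeq a b n).1 (dSeq a b n).2)

theorem zero_bmul (a : A) : bmul 0 a = 0 := by
  simpa using zero_circ a

theorem bmul_zero (a : A) : bmul a 0 = 0 := by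
  simpa using circ_zero a

/-- Multiplication by a circle product, with the summands grouped as in `dSeq`. -/
theorem add_add_bmul_bmul (a b c : A) :
    bmul (a + b + bmul a b) c = bmul a (bmul b c) + bmul a c + bmul b c := by
  have h := circ_assoc a b c
  rw [bmul_add, bmul_add, show bmul a b + a + b = a + b + bmul a b by abel] at h
  rw [← sub_eq_zero] at h ⊢
  rw [← h]
  abel

theorem dSeq_snd_mem_pow (a b : A) (n : ℕ) : (dSeq a b n).2 ∈ pow A (n + 1) := by
  induction n with
  | zero => exact Set.mem_univ _
  | succ n ih => exact AddSubmonoid.subset_closure ⟨_, Set.mem_univ _, _, ih, rfl⟩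

theorem dSeq_snd_eq_zero {s : ℕ} (h : pow A (s + 1) = {0}) (a b : A) {n : ℕ} (hn : s ≤ n) :
    (dSeq a b n).2 = 0 := by
  induction n, hn using Nat.le_induction with
  | base => simpa [h] using dSeq_snd_mem_pow a b s
  | succ n _ ih => simp only [dSeq, ih, bmul_zero]

/-- The expansion of `(a + b) · c` after `n` steps, with its remainder term. -/
theorem add_bmul_eq_sum_add_remainder (a b c : A) (n : ℕ) :
    bmul (a + b) c = bmul a c + bmul b c +
      ∑ i ∈ Finset.range n,
        ((-1 : ℤ) ^ (i + 1)) •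
          (bmul (bmul (dSeq a b i).1 (dSeq a b i).2) c
            - bmul (dSeq a b i).1 (bmul (dSeq a b i).2 c)) +
      ((-1 : ℤ) ^ n) • (bmul ((dSeq a b n).1 + (dSeq a b n).2) c
        - bmul (dSeq a b n).1 c - bmul (dSeq a b n).2 c) := by
  induction n with
  | zero => simp [dSeq]
  | succ n ih =>
    rw [ih, Finset.sum_range_succ]
    simp only [dSeq, add_add_bmul_bmul, pow_succ, mul_neg, mul_one, neg_smul, smul_sub, smul_add]
    abel

/-- Let `A` be a left brace with `Aˢ = 0`.  With `dᵢ, dᵢ'` defined from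
`a, b` as above, for every `c ∈ A`:
`(a+b)·c = a·c + b·c + Σ_{i=0}^{2s} (−1)^{i+1}·((dᵢ·dᵢ')·c − dᵢ·(dᵢ'·c))`. -/
theorem leftBrace_add_bmul_expansion
    (A : Type) [LeftBrace A] (s : ℕ) (hs : 1 ≤ s) (h : pow A s = {0})
    (a b c : A) :
    bmul (a + b) c = bmul a c + bmul b c +
      ∑ i ∈ Finset.range (2 * s + 1),
        ((-1 : ℤ) ^ (i + 1)) •
          (bmul (bmul (dSeq a b i).1 (dSeq a b i).2) c
            - bmul (dSeq a b i).1 (bmul (dSeq a b i).2 c)) := by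
  obtain ⟨t, rfl⟩ := Nat.exists_eq_add_of_le' hs
  rw [add_bmul_eq_sum_add_remainder a b c (2 * (t + 1) + 1),
    dSeq_snd_eq_zero h a b (n := 2 * (t + 1) + 1) (by omega)]
  simp [zero_bmul]

end LeftBrace

end Paper
end
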